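/- arXiv:2509.07155 — 2 statements merged into one kernel-verified Lean document; each statement's English description precedes it below -/
import Mathlib

section
/- Let N, k ≥ 1, let λ = (λ₁,…,λ_N) ∈ ℂ^N be nonresonant, let Λ = diag(λ₁,…,λ_N), and let F̃₂ be an N×N² complex matrix. Let à be the order-k Carleman matrix of (Λ, F̃₂). Then there exists an invertible linear operator Ṽ on ℂ^N ⊕ ℂ^{N²} ⊕ ⋯ ⊕ ℂ^{N^k} that is block upper-triangular with respect to this decomposition, with diagonal blocks Ṽ_{j,j} equal to the identity on ℂ^{N^j} for each j, such that à = Ṽ D Ṽ^{-1}, where D = Λ₁ ⊕ Λ₂ ⊕ ⋯ ⊕ Λ_k. In particular, à is diagonalizable. -/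
open Matrix

/-- `A_{j,j} = Σ_{l=0}^{j−1} I^{⊗l} ⊗ F₁ ⊗ I^{⊗(j−1−l)} : ℂ^{N^j} → ℂ^{N^j}`. -/
noncomputable def carlemanA1 (N : ℕ) (F1 : Matrix (Fin N) (Fin N) ℂ) (j : ℕ) :
    Matrix (Fin j → Fin N) (Fin j → Fin N) ℂ :=
  Matrix.of fun a b => ∑ l : Fin j,
    F1 (a l) (b l) * ∏ m ∈ Finset.univ.erase l, (if a m = b m then (1 : ℂ) else 0)

/-- `A_{j,j+1} = Σ_{l=0}^{j−1} I^{⊗l} ⊗ F₂ ⊗ I^{⊗(j−1−l)} : ℂ^{N^{j+1}} → ℂ^{N^j}`. -/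
noncomputable def carlemanA2 (N : ℕ) (F2 : Matrix (Fin N) (Fin N × Fin N) ℂ) (j : ℕ) :
    Matrix (Fin j → Fin N) (Fin (j + 1) → Fin N) ℂ :=
  Matrix.of fun a b => ∑ l : Fin j,
    F2 (a l) (b l.castSucc, b l.succ) *
      ∏ m ∈ Finset.univ.erase l,
        (if a m = b (if (m : ℕ) < (l : ℕ) then m.castSucc else m.succ) then (1 : ℂ) else 0)

/-- Index type of the direct sum `ℂ^N ⊕ ℂ^{N²} ⊕ ⋯ ⊕ ℂ^{N^k}`: level `j` (where
`j : Fin k` encodes the level `j+1`) together with a tuple in `{1,…,N}^{j+1}`. -/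
abbrev CIdx (N k : ℕ) : Type := (j : Fin k) × (Fin ((j : ℕ) + 1) → Fin N)

/-- The order-`k` Carleman matrix of the undriven quadratic system `(F₁, F₂)`, as a
linear operator on `ℂ^N ⊕ ℂ^{N²} ⊕ ⋯ ⊕ ℂ^{N^k}`: its only nonzero blocks are the
diagonal blocks `A_{j,j}` and the superdiagonal blocks `A_{j,j+1}` (`1 ≤ j ≤ k`,
no `A_{k,k+1}` block). -/
noncomputable def carlemanMatrixU (N k : ℕ) (F1 : Matrix (Fin N) (Fin N) ℂ)
    (F2 : Matrix (Fin N) (Fin N × Fin N) ℂ) : Matrix (CIdx N k) (CIdx N k) ℂ :=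
  Matrix.of fun a b =>
    if h : (b.1 : ℕ) = (a.1 : ℕ) then
      carlemanA1 N F1 ((a.1 : ℕ) + 1) a.2 (fun i => b.2 (Fin.cast (by omega) i))
    else if h2 : (b.1 : ℕ) = (a.1 : ℕ) + 1 then
      carlemanA2 N F2 ((a.1 : ℕ) + 1) a.2 (fun i => b.2 (Fin.cast (by omega) i))
    else 0

/-- `λ` is nonresonant: no eigenvalue is a nontrivial `ℕ`-combination of the eigenvalues. -/
def Nonresonant {N : ℕ} (lam : Fin N → ℂ) : Prop :=
  ∀ i : Fin N, ∀ α : Fin N → ℕ, 2 ≤ ∑ j, α j → lam i ≠ ∑ j, (α j : ℂ) * lam j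

/-- Convolution of noncommutative power series, encoded by their coefficients on words. -/
def wordConv {α R : Type*} [Semiring R] : (List α → R) → (List α → R) → List α → R
  | f, g, [] => f [] * g []
  | f, g, x :: w => f [] * g (x :: w) + wordConv (fun u => f (x :: u)) g w

section wordConv

variable {α R : Type*} [CommRing R]

theorem wordConv_add_left (f f' g : List α → R) (w : List α) :
    wordConv (fun u => f u + f' u) g w = wordConv f g w + wordConv f' g w := by
  induction w generalizing f f' with
  | nil => simp [wordConv, add_mul]
  | cons x w ih => simp only [wordConv, ih]; ring

theorem wordConv_mul_left (c : R) (f g : List α → R) (w : List α) :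
    wordConv (fun u => c * f u) g w = c * wordConv f g w := by
  induction w generalizing f with
  | nil => simp [wordConv, mul_assoc]
  | cons x w ih => simp only [wordConv, ih]; ring

theorem wordConv_sum_left {ι : Type*} (s : Finset ι) (f : ι → List α → R) (g : List α → R)
    (w : List α) :
    wordConv (fun u => ∑ i ∈ s, f i u) g w = ∑ i ∈ s, wordConv (f i) g w := by
  induction w generalizing f with
  | nil => simp [wordConv, Finset.sum_mul]
  | cons x w ih => simp only [wordConv, ih, Finset.sum_mul, Finset.sum_add_distrib]

theorem wordConv_add_right (f g g' : List α → R) (w : List α) :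
    wordConv f (fun u => g u + g' u) w = wordConv f g w + wordConv f g' w := by
  induction w generalizing f with
  | nil => simp [wordConv, mul_add]
  | cons x w ih => simp only [wordConv, ih]; ring

theorem wordConv_mul_right (c : R) (f g : List α → R) (w : List α) :
    wordConv f (fun u => c * g u) w = c * wordConv f g w := by
  induction w generalizing f with
  | nil => simp only [wordConv]; ring
  | cons x w ih => simp only [wordConv, ih]; ring

theorem wordConv_sum_right {ι : Type*} (s : Finset ι) (f : List α → R) (g : ι → List α → R)
    (w : List α) :
    wordConv f (fun u => ∑ i ∈ s, g i u) w = ∑ i ∈ s, wordConv f (g i) w := by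
  induction w generalizing f with
  | nil => simp [wordConv, Finset.mul_sum]
  | cons x w ih => simp only [wordConv, ih, Finset.mul_sum, Finset.sum_add_distrib]

theorem wordConv_assoc (f g h : List α → R) (w : List α) :
    wordConv (wordConv f g) h w = wordConv f (wordConv g h) w := by
  induction w generalizing f with
  | nil => simp [wordConv, mul_assoc]
  | cons x w ih =>
    simp only [wordConv, wordConv_add_left, wordConv_mul_left, ih]
    ring

/-- The Leibniz rule for the derivation that multiplies each word by its total weight. -/
theorem weight_mul_wordConv (lam : α → R) (f g : List α → R) (w : List α) :
    (w.map lam).sum * wordConv f g w =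
      wordConv (fun u => (u.map lam).sum * f u) g w +
        wordConv f (fun u => (u.map lam).sum * g u) w := by
  induction w generalizing f with
  | nil => simp [wordConv]
  | cons x w ih =>
    have h := ih (fun u => f (x :: u))
    simp only [wordConv, List.map_cons, List.sum_cons, List.map_nil, List.sum_nil, add_mul,
      wordConv_add_left, wordConv_mul_left] at h ⊢
    linear_combination h

theorem wordConv_congr_of_length_lt {f f' g g' : List α → R} {w : List α} (hg : g [] = 0)
    (hg' : g' [] = 0) (hf : ∀ u, u.length < w.length → f u = f' u)
    (hgg : ∀ u, u.length ≤ w.length → g u = g' u) : wordConv f g w = wordConv f' g' w := by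
  induction w generalizing f f' with
  | nil => simp [wordConv, hg, hg']
  | cons x w ih =>
    simp only [wordConv]
    rw [hf [] (by simp), hgg _ le_rfl]
    congr 1
    exact ih (fun u hu => hf _ (by simpa using hu)) (fun u hu => hgg _ (by simp; omega))

theorem wordConv_eq_of_vanish_lt {f g : List α → R} {w : List α}
    (hg : ∀ u, u.length < w.length → g u = 0) : wordConv f g w = f [] * g w := by
  induction w generalizing f with
  | nil => rfl
  | cons x w ih =>
    rw [wordConv, ih (fun u hu => hg u (by simp; omega)), hg w (by simp)]
    simp

/-- The product of the series `φ i` over the letters `i` of a word. -/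
def wordProd (φ : α → List α → R) : List α → List α → R
  | [], w => if w.isEmpty then 1 else 0
  | i :: a, w => wordConv (φ i) (wordProd φ a) w

theorem wordProd_eq_zero_of_length_lt {φ : α → List α → R} (h0 : ∀ i, φ i [] = 0)
    {a w : List α} (h : w.length < a.length) : wordProd φ a w = 0 := by
  induction a generalizing w with
  | nil => simp at h
  | cons i a ih =>
    simp only [List.length_cons] at h
    rw [wordProd, wordConv_eq_of_vanish_lt (fun u hu => ih (by omega)), h0, zero_mul]

theorem wordProd_eq_ite_of_length_eq [DecidableEq α] {φ : α → List α → R}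
    (h0 : ∀ i, φ i [] = 0) (h1 : ∀ i x, φ i [x] = if i = x then 1 else 0)
    {a w : List α} (h : a.length = w.length) : wordProd φ a w = if a = w then 1 else 0 := by
  induction a generalizing w with
  | nil =>
    cases w with
    | nil => simp [wordProd]
    | cons x w => simp at h
  | cons i a ih =>
    cases w with
    | nil => simp at h
    | cons x w =>
      simp only [List.length_cons, add_left_inj] at h
      rw [wordProd, wordConv, h0, zero_mul, zero_add,
        wordConv_eq_of_vanish_lt (fun u hu => wordProd_eq_zero_of_length_lt h0 (by omega)),
        h1, ih h]
      by_cases hi : i = x <;> simp [hi]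

end wordConv

theorem Nonresonant.ne_sum_map {N : ℕ} {lam : Fin N → ℂ} (h : Nonresonant lam) (i : Fin N)
    {w : List (Fin N)} (hw : 2 ≤ w.length) : lam i ≠ (w.map lam).sum := by
  have key : ∀ u : List (Fin N), ∑ j, u.count j = u.length ∧
      ∑ j, (u.count j : ℂ) * lam j = (u.map lam).sum := by
    intro u
    induction u with
    | nil => simp
    | cons x u ih =>
      constructor
      · simp [List.count_cons, Finset.sum_add_distrib, ih.1]
      · simp [List.count_cons, add_mul, Finset.sum_add_distrib, ih.2, add_comm]
  rw [← (key w).2]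
  exact h i _ (by rw [(key w).1]; exact hw)

/-- The approximations to the linearizing series obtained by iterating its recursion. -/
noncomputable def linearizingIter {N : ℕ} (lam : Fin N → ℂ)
    (F2 : Matrix (Fin N) (Fin N × Fin N) ℂ) : ℕ → Fin N → List (Fin N) → ℂ
  | 0, _, _ => 0
  | _ + 1, _, [] => 0
  | _ + 1, i, [x] => if i = x then 1 else 0
  | n + 1, i, x :: y :: w =>
    (∑ p, ∑ q, F2 i (p, q) *
      wordConv (linearizingIter lam F2 n p) (linearizingIter lam F2 n q) (x :: y :: w)) /
        (((x :: y :: w).map lam).sum - lam i)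

section linearization

variable {N : ℕ} {lam : Fin N → ℂ} {F2 : Matrix (Fin N) (Fin N × Fin N) ℂ}

theorem linearizingIter_nil (n : ℕ) (i : Fin N) : linearizingIter lam F2 n i [] = 0 := by
  cases n <;> simp [linearizingIter]

theorem wordConv_congr_of_nil {f f' g g' : List (Fin N) → ℂ} {w : List (Fin N)}
    (hf0 : f [] = 0) (hf0' : f' [] = 0) (hg : g [] = 0) (hg' : g' [] = 0)
    (hf : ∀ u, u.length < w.length → f u = f' u)
    (hgg : ∀ u, u.length < w.length → g u = g' u) : wordConv f g w = wordConv f' g' w := by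
  cases w with
  | nil => simp [wordConv, hf0, hf0']
  | cons x w =>
    rw [wordConv, wordConv, hf0, hf0', zero_mul, zero_mul]
    congr 1
    exact wordConv_congr_of_length_lt hg hg' (fun u hu => hf _ (by simpa using hu))
      (fun u hu => hgg _ (by simp; omega))

theorem linearizingIter_eq {n m : ℕ} {w : List (Fin N)} (hn : w.length < n) (hm : w.length < m)
    (i : Fin N) : linearizingIter lam F2 n i w = linearizingIter lam F2 m i w := by
  induction n generalizing m w i with
  | zero => omega
  | succ n ih =>
    obtain _ | m := m
    · omega
    match w with
    | [] => simp [linearizingIter_nil]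
    | [x] => simp [linearizingIter]
    | x :: y :: w =>
      simp only [linearizingIter]
      congr 1
      refine Finset.sum_congr rfl fun p _ => Finset.sum_congr rfl fun q _ => ?_
      congr 1
      apply wordConv_congr_of_nil <;> first
        | exact linearizingIter_nil _ _
        | exact fun u hu => ih (by omega) (by omega) _

/-- Formal Poincaré linearization in noncommuting variables. -/
theorem Nonresonant.exists_linearizing_series (hnr : Nonresonant lam)
    (F2 : Matrix (Fin N) (Fin N × Fin N) ℂ) :
    ∃ φ : Fin N → List (Fin N) → ℂ, (∀ i, φ i [] = 0) ∧
      (∀ i x, φ i [x] = if i = x then 1 else 0) ∧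
      ∀ i w, (w.map lam).sum * φ i w =
        lam i * φ i w + ∑ p, ∑ q, F2 i (p, q) * wordConv (φ p) (φ q) w := by
  refine ⟨fun i w => linearizingIter lam F2 (w.length + 1) i w,
    fun i => linearizingIter_nil _ _, fun i x => by simp [linearizingIter], fun i w => ?_⟩
  match w with
  | [] => simp [linearizingIter, wordConv]
  | [x] =>
    by_cases h : i = x <;> simp [linearizingIter, wordConv, h]
  | x :: y :: w =>
    have hne : ((x :: y :: w).map lam).sum - lam i ≠ 0 :=
      sub_ne_zero.2 (hnr.ne_sum_map i (by simp)).symm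
    rw [← sub_eq_iff_eq_add', ← sub_mul]
    beta_reduce
    rw [linearizingIter, mul_div_cancel₀ _ hne]
    refine Finset.sum_congr rfl fun p _ => Finset.sum_congr rfl fun q _ => ?_
    exact congrArg _ (wordConv_congr_of_nil (linearizingIter_nil _ _) (linearizingIter_nil _ _)
      (linearizingIter_nil _ _) (linearizingIter_nil _ _)
      (fun u hu => linearizingIter_eq hu (by omega) _)
      (fun u hu => linearizingIter_eq hu (by omega) _))

theorem carlemanA2_cons (j : ℕ) (i p : Fin N) (a : Fin j → Fin N) (c : Fin (j + 1) → Fin N) :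
    carlemanA2 N F2 (j + 1) (Fin.cons i a) (Fin.cons p c) =
      F2 i (p, c 0) * (if a = Fin.tail c then 1 else 0) +
        (if i = p then 1 else 0) * carlemanA2 N F2 j a c := by
  have herase : ∀ {n : ℕ} (l : Fin n) (f : Fin n → ℂ),
      ∏ m ∈ Finset.univ.erase l, f m = ∏ m, if m = l then 1 else f m := by
    intro n l f
    rw [← Finset.mul_prod_erase _ _ (Finset.mem_univ l), if_pos rfl, one_mul]
    exact Finset.prod_congr rfl fun m hm => by rw [if_neg (Finset.ne_of_mem_erase hm)]
  simp only [carlemanA2, Matrix.of_apply, herase]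
  rw [Fin.sum_univ_succ, Finset.mul_sum]
  congr 1
  · rw [Fin.prod_univ_succ]
    simp [Finset.prod_ite_zero, funext_iff, Fin.tail]
  · refine Finset.sum_congr rfl fun l _ => ?_
    rw [Fin.prod_univ_succ]
    have hcast : ∀ m : Fin j, (Fin.cons p c : Fin (j + 2) → Fin N)
        (if ((m.succ : Fin (j + 1)) : ℕ) < ((l.succ : Fin (j + 1)) : ℕ)
          then m.succ.castSucc else m.succ.succ) =
        c (if (m : ℕ) < (l : ℕ) then m.castSucc else m.succ) := by
      intro m
      by_cases h : (m : ℕ) < (l : ℕ) <;> simp [h]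
    simp only [Fin.cons_succ, Fin.succ_inj, ← Fin.succ_castSucc]
    simp only [Fin.succ_castSucc, hcast]
    simp [(Fin.succ_ne_zero l).symm]

theorem sum_fin_cons {α M : Type*} [Fintype α] [AddCommMonoid M] {n : ℕ}
    (f : (Fin (n + 1) → α) → M) : ∑ c, f c = ∑ p, ∑ c : Fin n → α, f (Fin.cons p c) := by
  rw [← Fintype.sum_prod_type' (f := fun p c => f (Fin.cons p c))]
  exact ((Fin.consEquiv fun _ => α).sum_comp f).symm

theorem sum_carlemanA2_cons_mul (j : ℕ) (i : Fin N) (a : Fin j → Fin N)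
    (G : List (Fin N) → ℂ) :
    ∑ c, carlemanA2 N F2 (j + 1) (Fin.cons i a) c * G (List.ofFn c) =
      ∑ p, ∑ q, F2 i (p, q) * G (p :: q :: List.ofFn a) +
        ∑ c, carlemanA2 N F2 j a c * G (i :: List.ofFn c) := by
  rw [sum_fin_cons]
  simp only [carlemanA2_cons, List.ofFn_cons, add_mul,
    Finset.sum_add_distrib]
  congr 1
  · refine Finset.sum_congr rfl fun p _ => ?_
    rw [sum_fin_cons]
    simp
  · rw [Finset.sum_comm]
    simp

theorem weight_mul_wordProd {φ : Fin N → List (Fin N) → ℂ}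
    (hφ : ∀ i w, (w.map lam).sum * φ i w =
      lam i * φ i w + ∑ p, ∑ q, F2 i (p, q) * wordConv (φ p) (φ q) w)
    {j : ℕ} (a : Fin j → Fin N) (w : List (Fin N)) :
    (w.map lam).sum * wordProd φ (List.ofFn a) w =
      (∑ l, lam (a l)) * wordProd φ (List.ofFn a) w +
        ∑ c, carlemanA2 N F2 j a c * wordProd φ (List.ofFn c) w := by
  induction j generalizing w with
  | zero => cases w <;> simp [wordProd, carlemanA2]
  | succ j ih =>
    obtain ⟨i, a, rfl⟩ : ∃ i a', a = Fin.cons i a' := ⟨a 0, Fin.tail a, by simp⟩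
    rw [sum_carlemanA2_cons_mul j i a (fun u => wordProd φ u w), List.ofFn_cons]
    simp only [wordProd]
    rw [weight_mul_wordConv]
    simp only [hφ, ih]
    simp only [wordConv_add_left, wordConv_mul_left, wordConv_sum_left, wordConv_add_right,
      wordConv_mul_right, wordConv_sum_right, Fin.sum_univ_succ, Fin.cons_zero, Fin.cons_succ]
    simp only [wordConv_assoc]
    ring

theorem carlemanA1_diagonal (j : ℕ) (a b : Fin j → Fin N) :
    carlemanA1 N (Matrix.diagonal lam) j a b = if a = b then ∑ l, lam (a l) else 0 := by
  simp only [carlemanA1, Matrix.of_apply]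
  split_ifs with h
  · subst h
    simp
  · refine Finset.sum_eq_zero fun l _ => ?_
    obtain ⟨m, hm⟩ := Function.ne_iff.1 h
    by_cases hml : m = l
    · subst hml
      rw [Matrix.diagonal_apply_ne _ hm, zero_mul]
    · rw [Finset.prod_eq_zero (Finset.mem_erase.2 ⟨hml, Finset.mem_univ m⟩) (if_neg hm),
        mul_zero]

theorem sum_carlemanMatrixU_mul {k : ℕ} (F1 : Matrix (Fin N) (Fin N) ℂ) (a : CIdx N k)
    (G : List (Fin N) → ℂ) (hG : ∀ u, k < u.length → G u = 0) :
    ∑ c : CIdx N k, carlemanMatrixU N k F1 F2 a c * G (List.ofFn c.2) =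
      ∑ c, carlemanA1 N F1 (a.1 + 1) a.2 c * G (List.ofFn c) +
        ∑ c, carlemanA2 N F2 (a.1 + 1) a.2 c * G (List.ofFn c) := by
  obtain ⟨⟨j, hj⟩, a⟩ := a
  rw [Fintype.sum_sigma, ← Finset.add_sum_erase _ _ (Finset.mem_univ (⟨j, hj⟩ : Fin k))]
  congr 1
  · simp [carlemanMatrixU]
  · by_cases hk : j + 1 < k
    · rw [Finset.sum_eq_single (⟨j + 1, hk⟩ : Fin k)]
      · simp [carlemanMatrixU]
      · intro l hl hl'
        refine Finset.sum_eq_zero fun c _ => ?_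
        have h1 : (l : ℕ) ≠ j := fun h => Finset.ne_of_mem_erase hl (Fin.ext h)
        have h2 : (l : ℕ) ≠ j + 1 := fun h => hl' (Fin.ext h)
        simp [carlemanMatrixU, h1, h2]
      · simp
    · rw [Finset.sum_eq_zero, Finset.sum_eq_zero]
      · intro c _
        rw [hG _ (by simp; omega), mul_zero]
      · intro l hl
        refine Finset.sum_eq_zero fun c _ => ?_
        have h1 : (l : ℕ) ≠ j := fun h => Finset.ne_of_mem_erase hl (Fin.ext h)
        have h2 : (l : ℕ) ≠ j + 1 := by omega
        simp [carlemanMatrixU, h1, h2]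

end linearization

theorem stmt8 {N k : ℕ} (hN : 1 ≤ N) (hk : 1 ≤ k)
    (lam : Fin N → ℂ) (hnr : Nonresonant lam)
    (F2 : Matrix (Fin N) (Fin N × Fin N) ℂ) :
    ∃ V : Matrix (CIdx N k) (CIdx N k) ℂ,
      IsUnit V.det ∧
      (∀ a b : CIdx N k, (b.1 : ℕ) < (a.1 : ℕ) → V a b = 0) ∧
      (∀ a b : CIdx N k, (a.1 : ℕ) = (b.1 : ℕ) → V a b = if a = b then 1 else 0) ∧
      carlemanMatrixU N k (Matrix.diagonal lam) F2 =
        V * Matrix.diagonal (fun a : CIdx N k => ∑ i, lam (a.2 i)) * V⁻¹ := by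
  obtain ⟨φ, h0, h1, hφ⟩ := hnr.exists_linearizing_series F2
  let V : Matrix (CIdx N k) (CIdx N k) ℂ :=
    Matrix.of fun a b => wordProd φ (List.ofFn a.2) (List.ofFn b.2)
  have hlow : ∀ a b : CIdx N k, (b.1 : ℕ) < (a.1 : ℕ) → V a b = 0 := fun a b h =>
    wordProd_eq_zero_of_length_lt h0 (by simpa using h)
  have hdiag : ∀ a b : CIdx N k, (a.1 : ℕ) = (b.1 : ℕ) → V a b = if a = b then 1 else 0 := by
    rintro ⟨j, a⟩ ⟨j', b⟩ h
    obtain rfl : j = j' := Fin.ext h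
    refine (wordProd_eq_ite_of_length_eq h0 h1 (by simp)).trans ?_
    simp only [List.ofFn_inj, Sigma.mk.injEq, heq_eq_eq, true_and]
  have hdet : IsUnit V.det := by
    have hV : V.BlockTriangular (fun a => a.1) := fun a b h => hlow a b h
    rw [hV.det]
    have hblock : ∀ j : Fin k, V.toSquareBlock (fun a => a.1) j = 1 := by
      intro j
      ext ⟨a, ha⟩ ⟨b, hb⟩
      simp only [Matrix.toSquareBlock_def, Matrix.of_apply, Matrix.one_apply, Subtype.mk.injEq]
      exact hdiag a b (by rw [ha, hb])
    simp [hblock]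
  refine ⟨V, hdet, hlow, hdiag, ?_⟩
  have hmul : carlemanMatrixU N k (Matrix.diagonal lam) F2 * V =
      V * Matrix.diagonal (fun a : CIdx N k => ∑ i, lam (a.2 i)) := by
    ext a b
    rw [Matrix.mul_diagonal, Matrix.mul_apply]
    refine (sum_carlemanMatrixU_mul _ a (fun u => wordProd φ u (List.ofFn b.2))
      fun u hu => wordProd_eq_zero_of_length_lt h0 ?_).trans ?_
    · have := b.1.isLt
      simp only [List.length_ofFn]
      omega
    · have h := weight_mul_wordProd hφ a.2 (List.ofFn b.2)
      simp only [List.map_ofFn, List.sum_ofFn, Function.comp_apply] at h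
      simp only [carlemanA1_diagonal, ite_mul, zero_mul, Finset.sum_ite_eq, Finset.mem_univ,
        if_true]
      rw [← h, mul_comm]
      rfl
  rw [← hmul, Matrix.mul_nonsing_inv_cancel_right _ _ hdet]
end

section
/- Let F be an N×N complex matrix and define the logarithmic norm μ(M) := λ_max((M + M†)/2), the largest eigenvalue of the Hermitian part. For every j ≥ 1, the Kronecker-sum operator A_j := Σ_{l=0}^{j−1} I^{⊗l} ⊗ F ⊗ I^{⊗(j−1−l)} on ℂ^{N^j} satisfies μ(A_j) = j·μ(F). Consequently, the block-diagonal operator H₁ := A₁ ⊕ A₂ ⊕ ⋯ ⊕ A_k on ℂ^N ⊕ ℂ^{N²} ⊕ ⋯ ⊕ ℂ^{N^k} satisfies μ(H₁) = max_{1 ≤ j ≤ k} j·μ(F); in particular, if μ(F) ≤ 0 then μ(H₁) = μ(F). -/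
open Matrix

/-- The Hermitian part `(M + M†)/2` of a square matrix is Hermitian. -/
theorem hermPart_isHermitian {ι : Type*} [Fintype ι] (M : Matrix ι ι ℂ) :
    (((2 : ℂ)⁻¹) • (M + Mᴴ)).IsHermitian := by
  have h : (M + Mᴴ).IsHermitian := Matrix.isHermitian_add_transpose_self M
  have hstar : star ((2 : ℂ)⁻¹) = (2 : ℂ)⁻¹ := by simp
  unfold Matrix.IsHermitian
  rw [Matrix.conjTranspose_smul, hstar, h]

/-- The logarithmic norm `μ(M) = λ_max((M + M†)/2)`: the largest eigenvalue of the
Hermitian part of `M`. -/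
noncomputable def logNorm {ι : Type*} [Fintype ι] [DecidableEq ι] (M : Matrix ι ι ℂ) : ℝ :=
  ⨆ i, (hermPart_isHermitian M).eigenvalues i

/-- The block-diagonal operator `H₁ = A₁ ⊕ A₂ ⊕ ⋯ ⊕ A_k` on `ℂ^N ⊕ ℂ^{N²} ⊕ ⋯ ⊕ ℂ^{N^k}`,
whose `j`-th diagonal block is the Kronecker-sum operator `A_j` associated with `F`. -/
noncomputable def blockDiagA1 (N k : ℕ) (F : Matrix (Fin N) (Fin N) ℂ) :
    Matrix (CIdx N k) (CIdx N k) ℂ :=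
  Matrix.of fun a b =>
    if h : (b.1 : ℕ) = (a.1 : ℕ) then
      carlemanA1 N F ((a.1 : ℕ) + 1) a.2 (fun i => b.2 (Fin.cast (by omega) i))
    else 0

/-- The real part of the quadratic form `x† M x`. -/
noncomputable def reForm {ι : Type*} [Fintype ι] (M : Matrix ι ι ℂ) (x : ι → ℂ) : ℝ :=
  (star x ⬝ᵥ M *ᵥ x).re

theorem re_star_dotProduct_self {ι : Type*} [Fintype ι] (x : ι → ℂ) :
    (star x ⬝ᵥ x).re = ∑ i, ‖x i‖ ^ 2 := by
  simp only [dotProduct, Pi.star_apply, Complex.re_sum]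
  refine Finset.sum_congr rfl fun i _ => ?_
  rw [← Complex.normSq_eq_norm_sq, RCLike.star_def, ← Complex.normSq_eq_conj_mul_self,
    Complex.ofReal_re]

theorem reForm_hermPart {ι : Type*} [Fintype ι] (M : Matrix ι ι ℂ) (x : ι → ℂ) :
    reForm ((2 : ℂ)⁻¹ • (M + Mᴴ)) x = reForm M x := by
  have h : star x ⬝ᵥ Mᴴ *ᵥ x = star (star x ⬝ᵥ M *ᵥ x) := by
    rw [star_dotProduct, star_mulVec, conjTranspose_conjTranspose, ← dotProduct_mulVec]
  simp only [reForm, smul_mulVec, add_mulVec, dotProduct_smul, dotProduct_add, h, smul_eq_mul]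
  simp [Complex.mul_re]
  ring

theorem reForm_smul_vec {ι : Type*} [Fintype ι] (M : Matrix ι ι ℂ) (s : ℂ) (x : ι → ℂ) :
    reForm M (s • x) = ‖s‖ ^ 2 * reForm M x := by
  simp only [reForm, star_smul, mulVec_smul, smul_dotProduct, dotProduct_smul, smul_eq_mul]
  rw [← mul_assoc, RCLike.star_def, Complex.mul_conj, Complex.re_ofReal_mul,
    Complex.normSq_eq_norm_sq]

theorem reForm_le_logNorm {ι : Type*} [Fintype ι] [DecidableEq ι] (M : Matrix ι ι ℂ)
    (x : ι → ℂ) : reForm M x ≤ logNorm M * ∑ i, ‖x i‖ ^ 2 := by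
  have hM := hermPart_isHermitian M
  set U : Matrix ι ι ℂ := hM.eigenvectorUnitary.1
  have hU : U * star U = 1 := Unitary.mul_star_self_of_mem hM.eigenvectorUnitary.2
  set y : ι → ℂ := star U *ᵥ x
  have hy : star y = star x ᵥ* U := by
    simp [y, star_mulVec, star_eq_conjTranspose]
  have hnorm : ∑ i, ‖x i‖ ^ 2 = ∑ i, ‖y i‖ ^ 2 := by
    rw [← re_star_dotProduct_self, ← re_star_dotProduct_self, hy, ← dotProduct_mulVec,
      mulVec_mulVec, hU, one_mulVec]
  have hform : reForm M x = ∑ i, hM.eigenvalues i * ‖y i‖ ^ 2 := by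
    rw [← reForm_hermPart, reForm]
    conv_lhs => rw [hM.spectral_theorem, Unitary.conjStarAlgAut_apply]
    rw [← mulVec_mulVec, ← mulVec_mulVec, dotProduct_mulVec]
    change (star x ᵥ* U ⬝ᵥ _ *ᵥ y).re = _
    rw [← hy]
    simp only [dotProduct, mulVec_diagonal, Pi.star_apply, Complex.re_sum, Function.comp_apply]
    refine Finset.sum_congr rfl fun i _ => ?_
    rw [mul_left_comm, RCLike.star_def, ← Complex.normSq_eq_conj_mul_self,
      ← Complex.normSq_eq_norm_sq]
    exact (Complex.re_ofReal_mul _ _).trans (by rw [Complex.ofReal_re]; rfl)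
  rw [hform, hnorm, Finset.mul_sum]
  exact Finset.sum_le_sum fun i _ => mul_le_mul_of_nonneg_right
    (le_ciSup (Set.finite_range hM.eigenvalues).bddAbove i) (sq_nonneg _)

theorem exists_reForm_eq_logNorm {ι : Type*} [Fintype ι] [DecidableEq ι] [Nonempty ι]
    (M : Matrix ι ι ℂ) :
    ∃ x : ι → ℂ, x ≠ 0 ∧ reForm M x = logNorm M * ∑ i, ‖x i‖ ^ 2 := by
  obtain ⟨i, hi⟩ := exists_eq_ciSup_of_finite (f := (hermPart_isHermitian M).eigenvalues)
  refine ⟨(hermPart_isHermitian M).eigenvectorBasis i, fun h => ?_, ?_⟩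
  · exact (hermPart_isHermitian M).eigenvectorBasis.orthonormal.ne_zero i
      (by ext j; exact congrFun h j)
  · rw [← reForm_hermPart, reForm, IsHermitian.mulVec_eigenvectorBasis, dotProduct_smul,
      Complex.smul_re, re_star_dotProduct_self, hi, smul_eq_mul, logNorm]

theorem sum_norm_sq_pos {ι : Type*} [Fintype ι] {x : ι → ℂ} (hx : x ≠ 0) :
    0 < ∑ i, ‖x i‖ ^ 2 := by
  obtain ⟨i, hi⟩ := Function.ne_iff.mp hx
  exact Finset.sum_pos' (fun _ _ => sq_nonneg _)
    ⟨i, Finset.mem_univ i, pow_pos (norm_pos_iff.mpr hi) 2⟩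

theorem le_logNorm_of_reForm_eq {ι : Type*} [Fintype ι] [DecidableEq ι] {M : Matrix ι ι ℂ}
    {c : ℝ} {x : ι → ℂ} (hx : x ≠ 0) (h : reForm M x = c * ∑ i, ‖x i‖ ^ 2) : c ≤ logNorm M :=
  le_of_mul_le_mul_right (h ▸ reForm_le_logNorm M x) (sum_norm_sq_pos hx)

theorem logNorm_le_of_reForm_le {ι : Type*} [Fintype ι] [DecidableEq ι] [Nonempty ι]
    {M : Matrix ι ι ℂ} {c : ℝ} (h : ∀ x, reForm M x ≤ c * ∑ i, ‖x i‖ ^ 2) : logNorm M ≤ c := by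
  obtain ⟨x, hx, hxM⟩ := exists_reForm_eq_logNorm M
  exact le_of_mul_le_mul_right (hxM ▸ h x) (sum_norm_sq_pos hx)

/-- The vector in the `l`-th tensor factor obtained from a tensor `x` by fixing all the other
indices to `r`. -/
def tensorSlice {ι α : Type*} [DecidableEq ι] (l : ι) (r : {m // m ≠ l} → α)
    (x : (ι → α) → ℂ) (c : α) : ℂ :=
  x ((Equiv.funSplitAt l α).symm (c, r))

theorem sum_norm_sq_eq_sum_tensorSlice {ι α : Type*} [Fintype ι] [DecidableEq ι] [Fintype α]
    (l : ι) (x : (ι → α) → ℂ) :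
    ∑ a, ‖x a‖ ^ 2 = ∑ r, ∑ c, ‖tensorSlice l r x c‖ ^ 2 := by
  rw [← (Equiv.funSplitAt l α).symm.sum_comp, Fintype.sum_prod_type_right]
  rfl

theorem prod_erase_funSplitAt_symm {ι α : Type*} [Fintype ι] [DecidableEq ι] [DecidableEq α]
    (l : ι) (c d : α) (r s : {m // m ≠ l} → α) :
    (∏ m ∈ Finset.univ.erase l, if (Equiv.funSplitAt l α).symm (c, r) m =
      (Equiv.funSplitAt l α).symm (d, s) m then (1 : ℂ) else 0) = if s = r then 1 else 0 := by
  split_ifs with h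
  · exact Finset.prod_eq_one fun m hm => by simp [Finset.ne_of_mem_erase hm, h]
  · obtain ⟨m, hm⟩ := Function.ne_iff.mp h
    exact Finset.prod_eq_zero (i := m.1) (by simp [m.2]) (by simp [m.2, hm.symm])

theorem reForm_carlemanA1 {N : ℕ} (F : Matrix (Fin N) (Fin N) ℂ) (j : ℕ)
    (x : (Fin j → Fin N) → ℂ) :
    reForm (carlemanA1 N F j) x = ∑ l, ∑ r, reForm F (tensorSlice l r x) := by
  have h : star x ⬝ᵥ carlemanA1 N F j *ᵥ x = ∑ l, ∑ a, ∑ b, star (x a) * (F (a l) (b l) *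
      (∏ m ∈ Finset.univ.erase l, if a m = b m then (1 : ℂ) else 0) * x b) := by
    simp only [dotProduct, mulVec, carlemanA1, of_apply, Pi.star_apply, Finset.sum_mul,
      Finset.mul_sum]
    rw [Finset.sum_comm (s := (Finset.univ : Finset (Fin j)))]
    exact Finset.sum_congr rfl fun a _ => Finset.sum_comm
  rw [reForm, h, Complex.re_sum]
  refine Finset.sum_congr rfl fun l _ => ?_
  simp only [reForm]
  rw [← Complex.re_sum]
  congr 1
  rw [← (Equiv.funSplitAt l (Fin N)).symm.sum_comp, Fintype.sum_prod_type_right]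
  refine Finset.sum_congr rfl fun r _ => ?_
  simp only [dotProduct, mulVec, Pi.star_apply, Finset.mul_sum]
  refine Finset.sum_congr rfl fun c _ => ?_
  rw [← (Equiv.funSplitAt l (Fin N)).symm.sum_comp, Fintype.sum_prod_type]
  refine Finset.sum_congr rfl fun d _ => ?_
  simp only [prod_erase_funSplitAt_symm]
  simp [tensorSlice]

theorem tensorSlice_prod {ι α : Type*} [Fintype ι] [DecidableEq ι] (l : ι)
    (r : {m // m ≠ l} → α) (y : α → ℂ) :
    tensorSlice l r (fun a => ∏ i, y (a i)) = (∏ m, y (r m)) • y := by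
  ext c
  rw [tensorSlice, Fintype.prod_eq_mul_prod_subtype_ne _ l, Pi.smul_apply, smul_eq_mul, mul_comm]
  congr 1
  · exact Finset.prod_congr rfl fun m _ => by simp [m.2]
  · simp

theorem logNorm_carlemanA1 {N : ℕ} (hN : 1 ≤ N) (F : Matrix (Fin N) (Fin N) ℂ) (j : ℕ) :
    logNorm (carlemanA1 N F j) = j * logNorm F := by
  have : Nonempty (Fin N) := ⟨⟨0, hN⟩⟩
  have hsum (x : (Fin j → Fin N) → ℂ) : j * logNorm F * ∑ a, ‖x a‖ ^ 2 =
      ∑ l, ∑ r, logNorm F * ∑ c, ‖tensorSlice l r x c‖ ^ 2 := by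
    simp only [← Finset.mul_sum, ← sum_norm_sq_eq_sum_tensorSlice]
    simp [mul_left_comm, mul_assoc]
  apply le_antisymm
  · refine logNorm_le_of_reForm_le fun x => ?_
    rw [reForm_carlemanA1, hsum]
    exact Finset.sum_le_sum fun l _ => Finset.sum_le_sum fun r _ => reForm_le_logNorm F _
  · obtain ⟨y, hy, hyF⟩ := exists_reForm_eq_logNorm F
    obtain ⟨i, hi⟩ := Function.ne_iff.mp hy
    refine le_logNorm_of_reForm_eq (x := fun a => ∏ m, y (a m))
      (Function.ne_iff.mpr ⟨fun _ => i, Finset.prod_ne_zero_iff.mpr fun _ _ => hi⟩) ?_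
    rw [reForm_carlemanA1, hsum]
    refine Finset.sum_congr rfl fun l _ => Finset.sum_congr rfl fun r _ => ?_
    rw [tensorSlice_prod, reForm_smul_vec, hyF]
    simp only [Pi.smul_apply, smul_eq_mul, norm_mul, mul_pow, ← Finset.mul_sum]
    ring

theorem reForm_blockDiagonal' {o : Type*} [Fintype o] [DecidableEq o] {m : o → Type*}
    [∀ i, Fintype (m i)] (M : ∀ i, Matrix (m i) (m i) ℂ) (x : (Σ i, m i) → ℂ) :
    reForm (blockDiagonal' M) x = ∑ i, reForm (M i) fun a => x ⟨i, a⟩ := by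
  simp only [reForm, ← Complex.re_sum]
  congr 1
  simp only [dotProduct, mulVec, Fintype.sum_sigma, Pi.star_apply]
  refine Finset.sum_congr rfl fun i _ => Finset.sum_congr rfl fun a _ => ?_
  congr 1
  rw [Finset.sum_eq_single i]
  · simp [blockDiagonal'_apply_eq]
  · intro i' _ hi'
    simp [blockDiagonal'_apply_ne _ _ _ hi'.symm]
  · simp

theorem logNorm_blockDiagonal' {o : Type*} [Fintype o] [DecidableEq o] [Nonempty o]
    {m : o → Type*} [∀ i, Fintype (m i)] [∀ i, DecidableEq (m i)] [∀ i, Nonempty (m i)]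
    (M : ∀ i, Matrix (m i) (m i) ℂ) :
    logNorm (blockDiagonal' M) = ⨆ i, logNorm (M i) := by
  apply le_antisymm
  · have : Nonempty (Σ i, m i) := nonempty_sigma.mpr ⟨Classical.arbitrary o, inferInstance⟩
    refine logNorm_le_of_reForm_le fun x => ?_
    rw [reForm_blockDiagonal', Fintype.sum_sigma, Finset.mul_sum]
    refine Finset.sum_le_sum fun i _ => (reForm_le_logNorm (M i) _).trans ?_
    exact mul_le_mul_of_nonneg_right (le_ciSup (Set.finite_range fun i => logNorm (M i)).bddAbove i)
      (Finset.sum_nonneg fun _ _ => sq_nonneg _)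
  · refine ciSup_le fun i => ?_
    obtain ⟨y, hy, hyM⟩ := exists_reForm_eq_logNorm (M i)
    obtain ⟨a, ha⟩ := Function.ne_iff.mp hy
    let z : ∀ i, m i → ℂ := Pi.single i y
    have hz : z i = y := Pi.single_eq_same (M := fun i => m i → ℂ) i y
    have hz' (i') (h : i' ≠ i) : z i' = 0 := Pi.single_eq_of_ne (M := fun i => m i → ℂ) h y
    refine le_logNorm_of_reForm_eq (x := fun p => z p.1 p.2)
      (Function.ne_iff.mpr ⟨⟨i, a⟩, by simpa [hz] using ha⟩) ?_
    rw [reForm_blockDiagonal', Fintype.sum_sigma, Finset.sum_eq_single i, Finset.sum_eq_single i]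
    · simpa only [hz] using hyM
    · intro i' _ h
      simp [hz' i' h]
    · simp
    · intro i' _ h
      change reForm (M i') (z i') = 0
      simp [hz' i' h, reForm]
    · simp

theorem blockDiagA1_eq_blockDiagonal' (N k : ℕ) (F : Matrix (Fin N) (Fin N) ℂ) :
    blockDiagA1 N k F = blockDiagonal' fun j : Fin k => carlemanA1 N F ((j : ℕ) + 1) := by
  ext ⟨i, a⟩ ⟨j, b⟩
  by_cases h : i = j
  · subst h
    simp [blockDiagA1, blockDiagonal'_apply_eq]
  · rw [blockDiagonal'_apply_ne _ _ _ h]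
    exact dif_neg fun h' => h (Fin.ext h'.symm)

theorem stmt16 {N : ℕ} (hN : 1 ≤ N) (F : Matrix (Fin N) (Fin N) ℂ) (k : ℕ) (hk : 1 ≤ k) :
    (∀ j : ℕ, 1 ≤ j → logNorm (carlemanA1 N F j) = (j : ℝ) * logNorm F) ∧
    (logNorm (blockDiagA1 N k F) = ⨆ j : Fin k, (((j : ℕ) : ℝ) + 1) * logNorm F) ∧
    (logNorm F ≤ 0 → logNorm (blockDiagA1 N k F) = logNorm F) := by
  have : Nonempty (Fin N) := ⟨⟨0, hN⟩⟩
  have : Nonempty (Fin k) := ⟨⟨0, hk⟩⟩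
  have hblock : logNorm (blockDiagA1 N k F) = ⨆ j : Fin k, (((j : ℕ) : ℝ) + 1) * logNorm F := by
    rw [blockDiagA1_eq_blockDiagonal', logNorm_blockDiagonal']
    simp only [logNorm_carlemanA1 hN, Nat.cast_add, Nat.cast_one]
  refine ⟨fun j _ => logNorm_carlemanA1 hN F j, hblock, fun hF => ?_⟩
  rw [hblock]
  apply le_antisymm
  · refine ciSup_le fun j => ?_
    nlinarith [mul_nonpos_of_nonneg_of_nonpos (Nat.cast_nonneg (α := ℝ) (j : ℕ)) hF]
  · refine le_ciSup_of_le (Set.finite_range _).bddAbove (⟨0, hk⟩ : Fin k) ?_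
    simp
end
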